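/- Assume Schanuel's Conjecture. In the setup described, there exists an infinite subset S′ of S such that the subgroup G of ℂˣ generated by {e^{μ_i s} : 1 ≤ i ≤ N, s ∈ S′} has finite rank, i.e. the ℚ-vector space ℚ ⊗_ℤ G (equivalently, the divisible hull of G) is finite dimensional over ℚ. -/

import Mathlib

open Complex Set

noncomputable section

/-- `f` is an exponential polynomial, i.e. an element of the ring `𝓔`. -/
def IsExpPoly (f : ℂ → ℂ) : Prop :=
  ∃ (N : ℕ) (lam mu : Fin N → ℂ),
    ∀ z : ℂ, f z = ∑ i, lam i * Complex.exp (mu i * z)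

/-- `h` divides `f` in the ring `𝓔`. -/
def EDvd (h f : ℂ → ℂ) : Prop :=
  ∃ q : ℂ → ℂ, IsExpPoly q ∧ f = h * q

/-- `f` is a unit of the ring `𝓔`. -/
def EUnit (f : ℂ → ℂ) : Prop :=
  IsExpPoly f ∧ ∃ g : ℂ → ℂ, IsExpPoly g ∧ f * g = 1

/-- `f` is irreducible in the ring `𝓔`. -/
def EIrreducible (f : ℂ → ℂ) : Prop :=
  IsExpPoly f ∧ f ≠ 0 ∧ ¬ EUnit f ∧
    ∀ g h : ℂ → ℂ, IsExpPoly g → IsExpPoly h → f = g * h → EUnit g ∨ EUnit h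

/-- canonical representation: pairwise distinct exponents, nonzero coefficients. -/
def IsCanonicalRep (f : ℂ → ℂ) {N : ℕ} (lam mu : Fin N → ℂ) : Prop :=
  (∀ i, lam i ≠ 0) ∧ Function.Injective mu ∧
    ∀ z : ℂ, f z = ∑ i, lam i * Complex.exp (mu i * z)

/-- `f` is a simple exponential polynomial: its support has `ℚ`-dimension 1. -/
def IsSimple (f : ℂ → ℂ) : Prop :=
  ∃ (N : ℕ) (lam mu : Fin N → ℂ), IsCanonicalRep f lam mu ∧
    Module.finrank ℚ (Submodule.span ℚ (Set.range mu)) = 1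

/-- Transcendence degree over `ℚ` of (the field generated by) a set of complex numbers. -/
noncomputable def trdegQ (s : Set ℂ) : Cardinal.{0} :=
  ⨆ t : {t : Finset ℂ // ↑t ⊆ s ∧ AlgebraicIndependent ℚ (Subtype.val : {x : ℂ // x ∈ t} → ℂ)},
    (t.1.card : Cardinal)

/-- Schanuel's Conjecture. -/
def SchanuelConjecture : Prop :=
  ∀ (n : ℕ) (lam : Fin n → ℂ), LinearIndependent ℚ lam →
    (n : Cardinal) ≤ trdegQ (Set.range lam ∪ Set.range fun i => Complex.exp (lam i))

abbrev QM : Matroid ℂ := AlgebraicIndependent.matroid ℚ ℂ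

lemma QM_mem_closure {X : Set ℂ} {x : ℂ} :
    x ∈ QM.closure X ↔ IsAlgebraic (Algebra.adjoin ℚ X) x := by
  rw [AlgebraicIndependent.matroid_closure_eq]; rfl

/-- relative algebraic closure of ℚ(X) in ℂ -/
def KK (X : Set ℂ) : IntermediateField ℚ ℂ where
  carrier := QM.closure X
  mul_mem' := by
    intro a b ha hb
    rw [QM_mem_closure] at *
    exact ha.mul hb
  add_mem' := by
    intro a b ha hb
    rw [QM_mem_closure] at *
    exact ha.add hb
  algebraMap_mem' := by
    intro r
    rw [QM_mem_closure]
    exact isAlgebraic_algebraMap (algebraMap ℚ (Algebra.adjoin ℚ X) r)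
  inv_mem' := by
    intro x hx
    rw [QM_mem_closure] at *
    exact hx.inv

lemma mem_KK {X : Set ℂ} {x : ℂ} : x ∈ KK X ↔ x ∈ QM.closure X := Iff.rfl

lemma subset_KK (X : Set ℂ) : X ⊆ KK X := QM.subset_closure X (by simp)

lemma KK_mono {X Y : Set ℂ} (h : X ⊆ Y) : KK X ≤ KK Y := QM.closure_subset_closure h

lemma KK_le {X Y : Set ℂ} (h : X ⊆ KK Y) : KK X ≤ KK Y :=
  QM.closure_subset_closure_of_subset_closure h

lemma rk_le_of_subset_KK {X Y : Set ℂ} (h : X ⊆ KK Y) : QM.eRk X ≤ QM.eRk Y := by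
  rw [← QM.eRk_closure_eq Y]; exact QM.eRk_mono h

lemma KK_root {X : Set ℂ} {x : ℂ} {n : ℕ} (hn : n ≠ 0) (h : x ^ n ∈ KK X) : x ∈ KK X := by
  rw [mem_KK, QM_mem_closure] at *
  exact IsAlgebraic.of_pow (Nat.pos_of_ne_zero hn) h

lemma algInd_of_rk {X : Set ℂ} {ι : Type} [Fintype ι] (y : ι → ℂ) (hX : QM.eRk X ≠ ⊤)
    (h : QM.eRk X + Fintype.card ι ≤ QM.eRk (X ∪ range y)) : AlgebraicIndependent (KK X) y := by
  obtain ⟨I, hI⟩ := QM.exists_isBasis X (by simp)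
  have hIe := hI.eRk_eq_encard
  have hIf : I.Finite := by
    rw [← Set.encard_ne_top_iff, ← hIe]; exact hX
  have hyf : (range y).encard ≤ Fintype.card ι := by
    rw [← image_univ]
    refine (Set.encard_image_le _ _).trans ?_
    simp
  have h2 : QM.eRk (I ∪ range y) = QM.eRk (X ∪ range y) := hI.eRk_eq_eRk_union _
  have h3 : (I ∪ range y).encard ≤ I.encard + Fintype.card ι :=
    (Set.encard_union_le _ _).trans (by gcongr)
  have h4 := QM.eRk_le_encard (I ∪ range y)
  rw [← h2, hIe] at h
  have hind : QM.Indep (I ∪ range y) := by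
    rw [Matroid.indep_iff_eRk_eq_encard_of_finite (hIf.union (finite_range y))]
    exact le_antisymm h4 (h3.trans h)
  have hfin : Fintype I := hIf.fintype
  have hinj : Function.Injective (Sum.elim y (Subtype.val : I → ℂ)) := by
    have h5 : (Fintype.card (ι ⊕ I) : ℕ∞) ≤ (range (Sum.elim y (Subtype.val : I → ℂ))).encard := by
      rw [Sum.elim_range, Subtype.range_coe, union_comm]
      refine le_trans ?_ (h.trans h4)
      rw [Fintype.card_sum, Set.encard_eq_coe_toFinset_card, Set.toFinset_card, add_comm]
      push_cast; rfl
    classical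
    have h6 : Fintype.card (ι ⊕ I) ≤ (Finset.univ.image (Sum.elim y (Subtype.val : I → ℂ))).card := by
      have : (range (Sum.elim y (Subtype.val : I → ℂ))) =
        ↑(Finset.univ.image (Sum.elim y (Subtype.val : I → ℂ))) := by simp
      rw [this, Set.encard_coe_eq_coe_finsetCard] at h5
      exact_mod_cast h5
    rw [← Finset.card_univ] at h6
    have := Finset.card_image_iff.mp (le_antisymm Finset.card_image_le h6)
    simpa using this
  have hr : AlgebraicIndependent ℚ (Sum.elim y (Subtype.val : I → ℂ)) := by
    rw [AlgebraicIndependent.matroid_indep_iff] at hind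
    have hind' : AlgebraicIndependent ℚ (Subtype.val : (I ∪ range y : Set ℂ) → ℂ) := hind
    have : ∀ a, Sum.elim y (Subtype.val : I → ℂ) a ∈ I ∪ range y := by
      rintro (a | a)
      · right; exact mem_range_self a
      · left; exact a.2
    exact hind'.comp (fun a => ⟨_, this a⟩) (fun a b hab => hinj (congrArg Subtype.val hab))
  have h7 := (AlgebraicIndependent.sumElim_iff.mp hr).2
  rw [Subtype.range_coe] at h7
  have hle : Algebra.adjoin ℚ I ≤ (KK X).toSubalgebra :=
    Algebra.adjoin_le (hI.subset.trans (subset_KK X))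
  let _ : Algebra (Algebra.adjoin ℚ I) (KK X) := (Subalgebra.inclusion hle).toRingHom.toAlgebra
  have : IsScalarTower (Algebra.adjoin ℚ I) (KK X) ℂ := .of_algebraMap_eq fun _ => rfl
  have : Algebra.IsAlgebraic (Algebra.adjoin ℚ I) (KK X) := ⟨fun ⟨z, hz⟩ => by
    rw [← isAlgebraic_algHom_iff (IsScalarTower.toAlgHom (Algebra.adjoin ℚ I) (KK X) ℂ)
      Subtype.val_injective]
    change IsAlgebraic _ z
    rw [mem_KK, ← hI.closure_eq_closure, QM_mem_closure] at hz
    exact hz⟩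
  exact h7.extendScalars (KK X)

lemma rk_union_image {X : Set ℂ} {ι : Type} [DecidableEq ι] (y : ι → ℂ)
    (h : ∀ i, y i ∉ KK (X ∪ y '' {i}ᶜ)) (J : Finset ι) :
    QM.eRk (X ∪ y '' J) = QM.eRk X + J.card := by
  induction J using Finset.induction_on with
  | empty => simp
  | insert i J hi ih =>
    rw [Finset.coe_insert, image_insert_eq, union_insert, Matroid.eRk_insert_eq_add_one, ih,
      Finset.card_insert_of_notMem hi]
    · push_cast; rw [add_assoc]
    · refine ⟨by simp, fun hm => h i (KK_mono ?_ hm)⟩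
      apply union_subset_union_right
      apply image_mono
      intro j hj hji
      simp at hji; subst hji; exact hi hj

lemma QM_rank_top {X : Set ℂ} (hX : QM.eRk X ≠ ⊤) : ∃ x, x ∉ KK X := by
  obtain ⟨I, hI⟩ := QM.exists_isBasis X (by simp)
  have hIf : I.Finite := by
    rw [← Set.encard_ne_top_iff, ← hI.eRk_eq_encard]; exact hX
  by_contra! hall
  have : Countable I := hIf.countable
  have h1 : Algebra.IsAlgebraic (Algebra.adjoin ℚ I) ℂ := ⟨fun x => by
    have := hall x
    rwa [mem_KK, ← hI.closure_eq_closure, QM_mem_closure] at this⟩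
  have h2 := Algebra.IsAlgebraic.cardinalMk_le_max (Algebra.adjoin ℚ I) ℂ
  have h3 : Countable (Algebra.adjoin ℚ I) := by
    rw [Algebra.adjoin_eq_range]
    have : Countable (MvPolynomial I ℚ) := by
      rw [← Cardinal.mk_le_aleph0_iff]
      refine (MvPolynomial.cardinalMk_le_max).trans ?_
      simp
    exact (MvPolynomial.aeval (Subtype.val : I → ℂ)).rangeRestrict_surjective.countable
  have h4 : Cardinal.mk (Algebra.adjoin ℚ I) ≤ Cardinal.aleph0 := Cardinal.mk_le_aleph0
  rw [Cardinal.mk_complex, max_eq_right h4] at h2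
  exact absurd h2 (not_le.mpr Cardinal.aleph0_lt_continuum)

lemma exists_generic {X : Set ℂ} (hX : QM.eRk X ≠ ⊤) (m : ℕ) :
    ∃ x : Fin m → ℂ, (∀ i, x i ≠ 0) ∧ QM.eRk (X ∪ range x) = QM.eRk X + m := by
  induction m with
  | zero => exact ⟨Fin.elim0, fun i => i.elim0, by simp⟩
  | succ m ih =>
    obtain ⟨x, hx0, hx⟩ := ih
    obtain ⟨z, hz⟩ := QM_rank_top (X := X ∪ range x) (by
      rw [hx]; exact WithTop.add_ne_top.mpr ⟨hX, ENat.natCast_ne_top m⟩)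
    refine ⟨Fin.cons z x, ?_, ?_⟩
    · intro i
      refine Fin.cases ?_ hx0 i
      rintro h
      simp at h; subst h
      exact hz (zero_mem _)
    · rw [Fin.range_cons, union_insert, Matroid.eRk_insert_eq_add_one ⟨by simp, hz⟩, hx]
      push_cast; rw [add_assoc]

lemma exp_smul_mem_KK {X : Set ℂ} {x : ℂ} (a : ℚ) (h : exp x ∈ KK X) : exp (a • x) ∈ KK X := by
  apply KK_root (n := a.den) a.den_nz
  have : exp (a • x) ^ a.den = exp x ^ a.num := by
    rw [← exp_nat_mul, ← exp_int_mul]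
    congr 1
    rw [Rat.smul_def, ← mul_assoc]
    congr 1
    have := Rat.den_mul_eq_num a
    exact_mod_cast congrArg (fun q : ℚ => (q : ℂ)) this
  rw [this]
  exact zpow_mem h _

lemma exp_span_mem_KK {X : Set ℂ} {B : Set ℂ} (φ : ℂ →ₗ[ℚ] ℂ) (h : ∀ b ∈ B, exp (φ b) ∈ KK X) {v : ℂ}
    (hv : v ∈ Submodule.span ℚ B) : exp (φ v) ∈ KK X := by
  induction hv using Submodule.span_induction with
  | mem x hx => exact h x hx
  | zero => simp [one_mem]
  | add x y hx hy h1 h2 => simp only [map_add, exp_add]; exact mul_mem h1 h2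
  | smul a x hx h1 => rw [map_smul]; exact exp_smul_mem_KK a h1

lemma smul_mem_KK {X : Set ℂ} {x : ℂ} (a : ℚ) (h : x ∈ KK X) : a • x ∈ KK X :=
  (KK X).smul_mem h

lemma span_mem_KK {X : Set ℂ} {B : Set ℂ} (h : B ⊆ KK X) : (Submodule.span ℚ B : Set ℂ) ⊆ KK X := by
  have : Submodule.span ℚ B ≤ (KK X).toSubalgebra.toSubmodule := Submodule.span_le.mpr h
  exact this

lemma rk_exp_le (L : Submodule ℚ ℂ) [FiniteDimensional ℚ L] (φ : ℂ →ₗ[ℚ] ℂ) :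
    QM.eRk ((fun v => exp (φ v)) '' L) ≤ Module.finrank ℚ L := by
  let b := Module.finBasis ℚ L
  have h : (fun v => exp (φ v)) '' L ⊆ KK (range fun i => exp (φ (b i))) := by
    rintro _ ⟨v, hv, rfl⟩
    apply exp_span_mem_KK (B := range fun i => (b i : ℂ)) φ
    · rintro _ ⟨i, rfl⟩; exact subset_KK _ ⟨i, rfl⟩
    · have := b.mem_span ⟨v, hv⟩
      have h2 := Submodule.mem_map_of_mem (f := L.subtype) this
      rw [Submodule.map_span, ← range_comp] at h2
      exact h2
  refine (rk_le_of_subset_KK h).trans ((QM.eRk_le_encard _).trans ?_)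
  rw [← image_univ]
  refine (Set.encard_image_le _ _).trans ?_
  simp

lemma SC_rk (hSC : SchanuelConjecture) (L : Submodule ℚ ℂ) [FiniteDimensional ℚ L] (X : Set ℂ)
    (h1 : (L : Set ℂ) ⊆ KK X) (h2 : ∀ v ∈ L, exp v ∈ KK X) : (Module.finrank ℚ L : ℕ∞) ≤ QM.eRk X := by
  let b := Module.finBasis ℚ L
  have hb : LinearIndependent ℚ (fun i => (b i : ℂ)) :=
    b.linearIndependent.map' L.subtype (by simp)
  have h := hSC _ _ hb
  set s := (Set.range fun i => (b i : ℂ)) ∪ Set.range fun i => Complex.exp (b i)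
  have hs : s ⊆ KK X := by
    rintro _ (⟨i, rfl⟩ | ⟨i, rfl⟩)
    · exact h1 (b i).2
    · exact h2 _ (b i).2
  refine le_trans ?_ (rk_le_of_subset_KK hs)
  by_contra! hlt
  have : trdegQ s < Module.finrank ℚ L := by
    have hk : ∃ k : ℕ, QM.eRk s = k := ⟨_, (ENat.natCast_toNat (ne_top_of_lt hlt)).symm⟩
    obtain ⟨k, hk⟩ := hk
    rw [hk] at hlt
    have hlt' : k < Module.finrank ℚ L := by exact_mod_cast hlt
    refine lt_of_le_of_lt ?_ (Nat.cast_lt.mpr hlt')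
    unfold trdegQ
    apply ciSup_le'
    rintro ⟨t, hts, ht⟩
    have hti : QM.Indep (t : Set ℂ) := by
      rw [AlgebraicIndependent.matroid_indep_iff]; exact ht
    have := hti.encard_le_eRk_of_subset hts
    rw [hk, Set.encard_coe_eq_coe_finsetCard] at this
    exact_mod_cast this
  exact absurd h (not_le.mpr this)

lemma lattice (U : Submodule ℚ ℂ) [FiniteDimensional ℚ U] (T : Finset ℂ) (hT : ∀ v ∈ T, v ∈ U) :
    ∃ (b : Module.Basis (Fin (Module.finrank ℚ U)) ℚ U) (w : ℂ) (e : ℂ → (Fin (Module.finrank ℚ U) →₀ ℕ)),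
      w ∈ U ∧ ∀ v ∈ T, v + w = ∑ i, (e v i) • (b i : ℂ) := by
  classical
  let b0 := Module.finBasis ℚ U
  let q : ℂ → Fin (Module.finrank ℚ U) → ℚ := fun v i => if h : v ∈ U then b0.repr ⟨v, h⟩ i else 0
  let D : ℕ := ∏ v ∈ T, ∏ i, (q v i).den
  have hD : D ≠ 0 := Finset.prod_ne_zero_iff.mpr fun v _ => Finset.prod_ne_zero_iff.mpr fun i _ =>
    (q v i).den_nz
  have hDq : (D : ℚ) ≠ 0 := by exact_mod_cast hD
  have hk : ∀ v ∈ T, ∀ i, ∃ k : ℤ, (k : ℚ) = D * q v i := by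
    intro v hv i
    have h1 : (q v i).den ∣ D :=
      (Finset.dvd_prod_of_mem (fun i => (q v i).den) (Finset.mem_univ i)).trans
        (Finset.dvd_prod_of_mem (fun v => ∏ i, (q v i).den) hv)
    obtain ⟨m, hm⟩ := h1
    refine ⟨m * (q v i).num, ?_⟩
    rw [hm]
    push_cast
    have := Rat.den_mul_eq_num (q v i)
    rw [← this]; ring
  choose! k hk using hk
  let b := b0.isUnitSMul (w := fun _ => (D : ℚ)⁻¹) (fun _ => (inv_ne_zero hDq).isUnit)
  let N : ℤ := ∑ v ∈ T, ∑ i, |k v i|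
  have hN : ∀ v ∈ T, ∀ i, 0 ≤ k v i + N := by
    intro v hv i
    have h1 : |k v i| ≤ ∑ i, |k v i| :=
      Finset.single_le_sum (f := fun i => |k v i|) (fun _ _ => abs_nonneg _) (Finset.mem_univ i)
    have h2 : ∑ i, |k v i| ≤ N :=
      Finset.single_le_sum (f := fun v => ∑ i, |k v i|)
        (fun _ _ => Finset.sum_nonneg fun _ _ => abs_nonneg _) hv
    have := neg_abs_le (k v i)
    linarith
  refine ⟨b, ∑ i, N • (b i : ℂ), fun v => Finsupp.equivFunOnFinite.symm fun i => (k v i + N).toNat,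
    U.sum_mem fun i _ => U.toAddSubgroup.zsmul_mem (b i).2 _, ?_⟩
  intro v hv
  have hvU := hT v hv
  have h1 : v = ∑ i, k v i • (b i : ℂ) := by
    have h2 := b0.sum_repr ⟨v, hvU⟩
    have h3 := congrArg Subtype.val h2
    simp only [Submodule.coe_sum, Submodule.coe_smul] at h3
    rw [← h3]
    refine Finset.sum_congr rfl fun i _ => ?_
    have h4 : b0.repr ⟨v, hvU⟩ i = q v i := by simp [q, hvU]
    rw [h3, h4]
    simp only [b, Module.Basis.isUnitSMul_apply, Submodule.coe_smul]
    rw [← Int.cast_smul_eq_zsmul ℚ, smul_smul, hk v hv i]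
    congr 1
    field_simp
  rw [h1, ← Finset.sum_add_distrib]
  refine Finset.sum_congr rfl fun i _ => ?_
  rw [← h1]
  simp only [Finsupp.equivFunOnFinite_symm_apply_apply]
  rw [← natCast_zsmul, Int.toNat_of_nonneg (hN v hv i), add_smul]

lemma exp_sum_nsmul {n : ℕ} (φ : ℂ →ₗ[ℚ] ℂ) (e : Fin n →₀ ℕ) (b : Fin n → ℂ) :
    exp (φ (∑ i, e i • b i)) = ∏ i, exp (φ (b i)) ^ e i := by
  rw [map_sum, exp_sum]
  refine Finset.prod_congr rfl fun i _ => ?_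
  rw [map_nsmul, nsmul_eq_mul, exp_nat_mul]

lemma exp_image_subset_KK (U : Submodule ℚ ℂ) {ι : Type} (b : Module.Basis ι ℚ U) (φ : ℂ →ₗ[ℚ] ℂ) :
    (fun v => exp (φ v)) '' U ⊆ KK (range fun i => exp (φ (b i))) := by
  rintro _ ⟨v, hv, rfl⟩
  apply exp_span_mem_KK (B := range fun i => (b i : ℂ)) φ
  · rintro _ ⟨i, rfl⟩; exact subset_KK _ ⟨i, rfl⟩
  · have := b.mem_span ⟨v, hv⟩
    have h2 := Submodule.mem_map_of_mem (f := U.subtype) this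
    rw [Submodule.map_span, ← range_comp] at h2
    exact h2

lemma coset_vanish {X : Set ℂ} (hX : QM.eRk X ≠ ⊤) (V' U : Submodule ℚ ℂ) [FiniteDimensional ℚ U]
    (hdisj : Disjoint V' U) (T : Finset ℂ) (hT : ∀ v ∈ T, v ∈ V' ⊔ U) (c : ℂ → ℂ)
    (hc : ∀ v ∈ T, c v ∈ KK X) (φ : ℂ →ₗ[ℚ] ℂ) (hV' : ∀ v ∈ V', exp (φ v) ∈ KK X)
    (hrk : QM.eRk X + Module.finrank ℚ U ≤ QM.eRk (X ∪ (fun v => exp (φ v)) '' U))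
    (hsum : ∑ v ∈ T, c v * exp (φ v) = 0) (t : ℂ) (ht : t ∈ T) [DecidablePred fun v => v - t ∈ V'] :
    ∑ v ∈ T with v - t ∈ V', c v * exp (φ v) = 0 := by
  classical
  have hd : ∀ v ∈ T, ∃ p ∈ V', ∃ q ∈ U, p + q = v := fun v hv => Submodule.mem_sup.mp (hT v hv)
  choose! p hp q hq hpq using hd
  obtain ⟨b, w, e, hw, he⟩ := lattice U (T.image q) (by
    intro v hv; obtain ⟨u, hu, rfl⟩ := Finset.mem_image.mp hv; exact hq u hu)
  let y : Fin (Module.finrank ℚ U) → ℂ := fun i => exp (φ (b i))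
  have hy : AlgebraicIndependent (KK X) y := by
    apply algInd_of_rk y hX
    rw [Fintype.card_fin]
    refine hrk.trans (rk_le_of_subset_KK (union_subset ?_ ?_))
    · exact subset_union_left.trans (subset_KK _)
    · exact (exp_image_subset_KK U b φ).trans (KK_mono subset_union_right)
  have hpc : ∀ v ∈ T, c v * exp (φ (p v)) ∈ KK X := fun v hv => mul_mem (hc v hv) (hV' _ (hp v hv))
  let a : ℂ → KK X := fun v => if h : v ∈ T then ⟨_, hpc v h⟩ else 0
  have ha : ∀ v ∈ T, (a v : ℂ) = c v * exp (φ (p v)) := fun v hv => by simp [a, hv]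
  let P : MvPolynomial (Fin (Module.finrank ℚ U)) (KK X) :=
    ∑ v ∈ T, MvPolynomial.monomial (e (q v)) (a v)
  have hmon : ∀ v ∈ T, exp (φ (q v)) * exp (φ w) = ∏ i, y i ^ (e (q v) i) := by
    intro v hv
    rw [← exp_add, ← map_add, he _ (Finset.mem_image_of_mem q hv), exp_sum_nsmul]
  have hP : MvPolynomial.aeval y P = 0 := by
    rw [map_sum]
    have : ∀ v ∈ T, MvPolynomial.aeval y (MvPolynomial.monomial (e (q v)) (a v)) =
        (c v * exp (φ v)) * exp (φ w) := by
      intro v hv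
      rw [MvPolynomial.aeval_monomial, Finsupp.prod_fintype _ _ (by simp), ← hmon v hv]
      change (a v : ℂ) * _ = _
      rw [ha v hv]
      have h9 : exp (φ v) = exp (φ (p v)) * exp (φ (q v)) := by
        rw [← exp_add, ← map_add, hpq v hv]
      rw [h9]
      ring
    rw [Finset.sum_congr rfl this, ← Finset.sum_mul, hsum, zero_mul]
  have hP0 : P = 0 := hy (by rw [hP, map_zero])
  have hcoef := congrArg (MvPolynomial.coeff (e (q t))) hP0
  simp only [P, MvPolynomial.coeff_sum, MvPolynomial.coeff_monomial, MvPolynomial.coeff_zero] at hcoef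
  rw [← Finset.sum_filter] at hcoef
  have heq : ∀ v ∈ T, (e (q v) = e (q t) ↔ v - t ∈ V') := by
    intro v hv
    constructor
    · intro h
      have h1 := he _ (Finset.mem_image_of_mem q hv)
      rw [h, ← he _ (Finset.mem_image_of_mem q ht)] at h1
      have h2 : q v = q t := by simpa using h1
      rw [← hpq v hv, ← hpq t ht, h2, add_sub_add_right_eq_sub]
      exact sub_mem (hp v hv) (hp t ht)
    · intro h
      have h1 : q v - q t ∈ V' := by
        have : q v - q t = (v - t) - (p v - p t) := by
          conv_rhs => rw [← hpq v hv, ← hpq t ht]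
          rw [hpq v hv, hpq t ht]
          linear_combination hpq v hv - hpq t ht
        rw [this]; exact sub_mem h (sub_mem (hp v hv) (hp t ht))
      have h2 := Submodule.disjoint_def.mp hdisj _ h1 (sub_mem (hq v hv) (hq t ht))
      rw [sub_eq_zero.mp h2]
  rw [Finset.filter_congr heq] at hcoef
  have h3 := congrArg (Subtype.val) hcoef
  have h4 : ∑ v ∈ T with v - t ∈ V', c v * exp (φ v) =
     (∑ v ∈ T with v - t ∈ V', (a v : ℂ)) * exp (φ (q t)) := by
    rw [Finset.sum_mul]
    refine Finset.sum_congr rfl fun v hv => ?_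
    obtain ⟨hv, hvt⟩ := Finset.mem_filter.mp hv
    have h2 : q v = q t := by
      have h1 := he _ (Finset.mem_image_of_mem q hv)
      rw [(heq v hv).mpr hvt, ← he _ (Finset.mem_image_of_mem q ht)] at h1
      simpa using h1
    rw [ha v hv, mul_assoc, ← exp_add, ← map_add, ← h2, hpq v hv]
  rw [h4]
  have h5 : (∑ v ∈ T with v - t ∈ V', (a v : ℂ)) = 0 := by
    simpa using h3
  rw [h5, zero_mul]

lemma gauss_aux {A L : Type} [CommRing A] [IsDomain A] [UniqueFactorizationMonoid A]
    [Field L] (ψ : A →+* L) (hψ : Function.Injective ψ) (y : L) (P Q : Polynomial A)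
    (hP1 : P.IsPrimitive) (hP2 : Irreducible P)
    (hP : Polynomial.eval₂ ψ y P = 0)
    (hQ : Polynomial.eval₂ ψ y Q = 0) : P ∣ Q := by
  let F := FractionRing A
  letI : Algebra F L := (IsFractionRing.lift (K := F) (g := ψ) hψ).toAlgebra
  have hroot : ∀ R : Polynomial A, Polynomial.eval₂ ψ y R = 0 →
      Polynomial.aeval y (R.map (algebraMap A F)) = 0 := by
    intro R hR
    rw [Polynomial.aeval_def, Polynomial.eval₂_map, ← hR]
    congr 1
    refine RingHom.ext fun a => ?_
    exact IsFractionRing.lift_algebraMap hψ a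
  letI : NormalizedGCDMonoid A := Classical.choice inferInstance
  have hP3 := (hP1.irreducible_iff_irreducible_map_fraction_map (K := F)).mp hP2
  have hint : IsIntegral F y := by
    rw [← isAlgebraic_iff_isIntegral]
    exact ⟨_, hP3.ne_zero, hroot P hP⟩
  have hm := minpoly.irreducible hint
  have d1 := hm.dvd_symm hP3 (minpoly.dvd F _ (hroot P hP))
  have d2 := minpoly.dvd F _ (hroot Q hQ)
  exact hP1.dvd_of_fraction_map_dvd_fraction_map (d1.trans d2)

lemma gauss {K L σ : Type} [Field K] [Field L] [Algebra K L] (x : Option σ → L)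
    (hx : AlgebraicIndependent K (fun i => x (some i))) (P Q : MvPolynomial (Option σ) K)
    (hP : Irreducible P) (hPx : MvPolynomial.aeval x P = 0)
    (hQx : MvPolynomial.aeval x Q = 0) : P ∣ Q := by
  let ψ : MvPolynomial σ K →ₐ[K] L := MvPolynomial.aeval fun i => x (some i)
  have hψ : Function.Injective ψ := hx
  let E := MvPolynomial.optionEquivLeft K σ
  have hev : ∀ R : MvPolynomial (Option σ) K,
      MvPolynomial.aeval x R = Polynomial.eval₂ ψ.toRingHom (x none) (E R) := by
    intro R
    have : (MvPolynomial.aeval x).toRingHom =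
        (Polynomial.eval₂RingHom ψ.toRingHom (x none)).comp E.toRingEquiv.toRingHom := by
      apply MvPolynomial.ringHom_ext
      · intro r; simp [E, ψ]
      · rintro (_ | i) <;> simp [E, ψ]
    exact congrArg (fun f => f R) this
  have hprim : ∀ R : MvPolynomial (Option σ) K, Irreducible R → MvPolynomial.aeval x R = 0 →
      (E R).IsPrimitive ∧ Irreducible (E R) := by
    intro R hR hRx
    have hi : Irreducible (E R) := (MulEquiv.irreducible_iff E.toMulEquiv).mpr hR
    refine ⟨hi.isPrimitive ?_, hi⟩
    intro h0
    rw [hev, Polynomial.eq_C_of_natDegree_eq_zero h0, Polynomial.eval₂_C] at hRx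
    have := hψ (hRx.trans (map_zero ψ).symm)
    apply hi.ne_zero
    rw [Polynomial.eq_C_of_natDegree_eq_zero h0, this, map_zero]
  obtain ⟨hP1, hP2⟩ := hprim P hP hPx
  have d3 := gauss_aux ψ.toRingHom hψ (x none) (E P) (E Q) hP1 hP2 ((hev P).symm.trans hPx)
    ((hev Q).symm.trans hQx)
  exact (map_dvd_iff E.toMulEquiv).mp d3

def ZeroAt (T : Finset ℂ) (C : Set (ℂ → ℂ)) (φ : ℂ →ₗ[ℚ] ℂ) : Prop :=
  ∀ c ∈ C, ∑ v ∈ T, c v * exp (φ v) = 0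

def Good (V : Submodule ℚ ℂ) (T : Finset ℂ) (C : Set (ℂ → ℂ)) (E0 : Set ℂ) : Prop :=
  ∀ φ : ℂ →ₗ[ℚ] ℂ, ZeroAt T C φ →
    QM.eRk (E0 ∪ (fun v => exp (φ v)) '' V) + 2 ≤ QM.eRk E0 + Module.finrank ℚ V

def ms (s : ℂ) : ℂ →ₗ[ℚ] ℂ := LinearMap.mulRight ℚ s

lemma ms_apply (s v : ℂ) : ms s v = v * s := rfl

open Classical in
def newT (W : Submodule ℚ ℂ) (T : Finset ℂ) : Finset ℂ :=
  ((T ×ˢ T).image (fun p => p.1 - p.2)).filter (· ∈ W)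

open Classical in
def newC (T : Finset ℂ) (C : Set (ℂ → ℂ)) : Set (ℂ → ℂ) :=
  {d | ∃ c ∈ C, ∃ t ∈ T, d = fun u => if u + t ∈ T then c (u + t) else 0}

lemma mem_newT {W : Submodule ℚ ℂ} {T : Finset ℂ} {u : ℂ} :
    u ∈ newT W T ↔ (∃ v ∈ T, ∃ t ∈ T, v - t = u) ∧ u ∈ W := by
  simp only [newT, Finset.mem_filter, Finset.mem_image, Finset.mem_product, Prod.exists]
  constructor
  · rintro ⟨⟨a, b, ⟨h1, h2⟩, h3⟩, h4⟩; exact ⟨⟨a, h1, b, h2, h3⟩, h4⟩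
  · rintro ⟨⟨a, h1, b, h2, h3⟩, h4⟩; exact ⟨⟨a, b, ⟨h1, h2⟩, h3⟩, h4⟩

open Classical in
lemma sum_shift (W : Submodule ℚ ℂ) (T : Finset ℂ) (c : ℂ → ℂ) (φ : ℂ →ₗ[ℚ] ℂ) (t : ℂ) (ht : t ∈ T) :
    exp (φ t) * ∑ u ∈ newT W T, (if u + t ∈ T then c (u + t) else 0) * exp (φ u) =
      ∑ v ∈ T with v - t ∈ W, c v * exp (φ v) := by
  simp only [ite_mul, zero_mul]
  rw [← Finset.sum_filter, Finset.mul_sum]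
  refine Finset.sum_nbij' (fun u => u + t) (fun v => v - t) ?_ ?_ ?_ ?_ ?_
  · intro u hu
    rw [Finset.mem_filter, mem_newT] at hu
    rw [Finset.mem_filter]
    exact ⟨hu.2, by simpa using hu.1.2⟩
  · intro v hv
    rw [Finset.mem_filter] at hv
    rw [Finset.mem_filter, mem_newT]
    exact ⟨⟨⟨v, hv.1, t, ht, rfl⟩, hv.2⟩, by simpa using hv.1⟩
  · intro u _; simp
  · intro u _; simp
  · intro u _
    rw [map_add, exp_add]; ring

open Classical in
lemma zeroAt_of_classes (W : Submodule ℚ ℂ) (T : Finset ℂ) (F : ℂ → ℂ)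
    (h : ∀ t ∈ T, ∑ v ∈ T with v - t ∈ W, F v = 0) : ∑ v ∈ T, F v = 0 := by
  rw [← Finset.sum_fiberwise_of_maps_to (s := T) (t := T.image (W.mkQ)) (g := W.mkQ)
    (fun v hv => Finset.mem_image_of_mem _ hv)]
  refine Finset.sum_eq_zero fun k hk => ?_
  obtain ⟨t, ht, rfl⟩ := Finset.mem_image.mp hk
  rw [← h t ht]
  refine Finset.sum_congr ?_ fun _ _ => rfl
  refine Finset.filter_congr fun v hv => ?_
  exact Submodule.Quotient.eq W

lemma good_inherit (V VP W : Submodule ℚ ℂ) [FiniteDimensional ℚ V] (hVP : VP ≤ V) (T : Finset ℂ)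
    (C : Set (ℂ → ℂ)) (E0 : Set ℂ) (hE0 : QM.eRk E0 ≠ ⊤)
    (hdiff : ∀ u ∈ newT W T, u ∈ VP) (hG : Good V T C E0) : Good VP (newT W T) (newC T C) E0 := by
  classical
  intro φ' hφ'
  have : FiniteDimensional ℚ VP := Submodule.finiteDimensional_of_le hVP
  set X : Set ℂ := E0 ∪ (fun v => exp (φ' v)) '' VP with hXdef
  have hX : QM.eRk X ≠ ⊤ := by
    have h1 := QM.eRk_union_le_eRk_add_eRk E0 ((fun v => exp (φ' v)) '' VP)
    refine ne_top_of_le_ne_top ?_ (h1.trans (add_le_add_right (rk_exp_le VP φ') _))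
    exact WithTop.add_ne_top.mpr ⟨hE0, ENat.natCast_ne_top _⟩
  obtain ⟨Q, hQ⟩ := Submodule.exists_isCompl VP
  let U := Q ⊓ V
  have : FiniteDimensional ℚ U := Submodule.finiteDimensional_of_le inf_le_right
  have hsup : VP ⊔ U = V := by
    rw [← sup_inf_assoc_of_le Q hVP, hQ.sup_eq_top, top_inf_eq]
  have hinf : VP ⊓ U = ⊥ := by
    rw [← inf_assoc, hQ.inf_eq_bot, bot_inf_eq]
  have hdim : Module.finrank ℚ V = Module.finrank ℚ VP + Module.finrank ℚ U := by
    have := Submodule.finrank_sup_add_finrank_inf_eq VP U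
    rw [hsup, hinf] at this
    simpa using this
  let b := Module.finBasis ℚ U
  obtain ⟨x, hx0, hx⟩ := exists_generic hX (Module.finrank ℚ U)
  obtain ⟨g, hg⟩ := LinearMap.exists_extend (b.constr ℚ fun i => log (x i))
  let pr := VP.projection Q hQ
  let φ : ℂ →ₗ[ℚ] ℂ := φ' ∘ₗ pr + g ∘ₗ (LinearMap.id - pr)
  have hφ1 : ∀ v ∈ VP, φ v = φ' v := by
    intro v hv
    have : pr v = v := Submodule.projection_apply_left hQ ⟨v, hv⟩
    simp [φ, this]
  have hφ2 : ∀ i, φ (b i) = log (x i) := by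
    intro i
    have : pr (b i) = 0 := (Submodule.projection_apply_eq_zero_iff hQ).mpr (b i).2.1
    have h2 := congrArg (fun f => f (b i)) hg
    simp at h2
    simp [φ, this, h2]
  have hz : ZeroAt T C φ := by
    intro c hc
    refine zeroAt_of_classes W T _ fun t ht => ?_
    rw [← sum_shift W T c φ t ht]
    have h1 := hφ' _ ⟨c, hc, t, ht, rfl⟩
    have h2 : ∑ u ∈ newT W T, (if u + t ∈ T then c (u + t) else 0) * exp (φ u) =
      ∑ u ∈ newT W T, (if u + t ∈ T then c (u + t) else 0) * exp (φ' u) :=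
      Finset.sum_congr rfl fun u hu => by rw [hφ1 u (hdiff u hu)]
    rw [h2, h1, mul_zero]
  have h3 := hG φ hz
  have h4 : X ∪ range x ⊆ E0 ∪ (fun v => exp (φ v)) '' V := by
    rintro z ((hz | ⟨v, hv, rfl⟩) | ⟨i, rfl⟩)
    · exact Or.inl hz
    · exact Or.inr ⟨v, hVP hv, by simp only [hφ1 v hv]⟩
    · exact Or.inr ⟨b i, (b i).2.2, by simp only [hφ2, exp_log (hx0 i)]⟩
  have h5 := QM.eRk_mono h4
  rw [hx] at h5
  have h6 : (QM.eRk X + 2) + Module.finrank ℚ U ≤ (QM.eRk E0 + Module.finrank ℚ VP) + Module.finrank ℚ U := by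
    calc (QM.eRk X + 2) + Module.finrank ℚ U = QM.eRk X + Module.finrank ℚ U + 2 := by
          rw [add_right_comm]
      _ ≤ _ := by grw [h5]
      _ ≤ _ := h3
      _ = _ := by rw [hdim]; push_cast; rw [add_assoc]
  exact (ENat.add_le_add_iff_right (ENat.natCast_ne_top _)).mp h6

def LL (V : Submodule ℚ ℂ) (A : Finset ℂ) : Submodule ℚ ℂ := A.sup fun s => V.map (ms s)

def XX (V : Submodule ℚ ℂ) (E0 : Set ℂ) (A : Finset ℂ) : Set ℂ := E0 ∪ A ∪ exp '' (LL V A)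

instance LL_fd (V : Submodule ℚ ℂ) [FiniteDimensional ℚ V] (A : Finset ℂ) :
    FiniteDimensional ℚ (LL V A) := by
  unfold LL; infer_instance

lemma XX_fin (V : Submodule ℚ ℂ) [FiniteDimensional ℚ V] (E0 : Set ℂ) (hE0 : QM.eRk E0 ≠ ⊤)
    (A : Finset ℂ) : QM.eRk (XX V E0 A) ≠ ⊤ := by
  have h1 := QM.eRk_union_le_eRk_add_eRk (E0 ∪ A) (exp '' (LL V A))
  have h2 := QM.eRk_union_le_eRk_add_encard E0 A
  have h3 := rk_exp_le (LL V A) LinearMap.id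
  refine ne_top_of_le_ne_top ?_ (h1.trans (add_le_add h2 h3))
  refine WithTop.add_ne_top.mpr ⟨WithTop.add_ne_top.mpr ⟨hE0, ?_⟩, ENat.natCast_ne_top _⟩
  exact Set.encard_ne_top_iff.mpr A.finite_toSet

lemma LL_KK (V : Submodule ℚ ℂ) (E0 : Set ℂ) (hV : (V : Set ℂ) ⊆ KK E0)
    (A : Finset ℂ) : (LL V A : Set ℂ) ⊆ KK (XX V E0 A) := by
  have : LL V A ≤ (KK (XX V E0 A)).toSubalgebra.toSubmodule := by
    refine Finset.sup_le fun s hs => ?_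
    rintro _ ⟨v, hv, rfl⟩
    refine (KK (XX V E0 A)).mul_mem (KK_mono ?_ (hV hv)) (subset_KK _ ?_)
    · exact subset_union_left.trans subset_union_left
    · exact Or.inl (Or.inr hs)
  exact this

lemma LL_le_XX (hSC : SchanuelConjecture) (V : Submodule ℚ ℂ) [FiniteDimensional ℚ V] (E0 : Set ℂ)
    (hV : (V : Set ℂ) ⊆ KK E0) (A : Finset ℂ) :
    (Module.finrank ℚ (LL V A) : ℕ∞) ≤ QM.eRk (XX V E0 A) :=
  SC_rk hSC _ _ (LL_KK V E0 hV A) fun v hv => subset_KK _ (Or.inr ⟨v, hv, rfl⟩)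

lemma exists_min (hSC : SchanuelConjecture) (V : Submodule ℚ ℂ) [FiniteDimensional ℚ V] (E0 : Set ℂ)
    (hE0 : QM.eRk E0 ≠ ⊤) (hV : (V : Set ℂ) ⊆ KK E0) :
    ∃ A : Finset ℂ, ∀ B : Finset ℂ, QM.eRk (XX V E0 A) + Module.finrank ℚ (LL V B) ≤
      QM.eRk (XX V E0 B) + Module.finrank ℚ (LL V A) := by
  classical
  have key : ∀ A : Finset ℂ, ∃ k : ℕ, QM.eRk (XX V E0 A) = ((Module.finrank ℚ (LL V A) + k : ℕ) : ℕ∞) := by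
    intro A
    have h1 := LL_le_XX hSC V E0 hV A
    obtain ⟨m, hm⟩ := ENat.ne_top_iff_exists.mp (XX_fin V E0 hE0 A)
    rw [← hm] at h1 ⊢
    have h2 : Module.finrank ℚ (LL V A) ≤ m := by exact_mod_cast h1
    exact ⟨m - Module.finrank ℚ (LL V A), by rw [Nat.add_sub_cancel' h2]⟩
  choose k hk using key
  have hex : ∃ m, ∃ A, k A = m := ⟨_, ∅, rfl⟩
  obtain ⟨A, hA⟩ := Nat.find_spec hex
  refine ⟨A, fun B => ?_⟩
  have h2 : k A ≤ k B := by
    rw [hA]; exact Nat.find_min' hex ⟨B, rfl⟩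
  rw [hk A, hk B]
  norm_cast
  omega

open Classical in
lemma step (V : Submodule ℚ ℂ) [FiniteDimensional ℚ V] (E0 : Set ℂ)
    (hE0 : QM.eRk E0 ≠ ⊤) (hV : (V : Set ℂ) ⊆ KK E0) (T : Finset ℂ) (hT : ∀ v ∈ T, v ∈ V)
    (C : Set (ℂ → ℂ)) (hC : ∀ c ∈ C, ∀ v ∈ T, c v ∈ KK E0) (hG : Good V T C E0)
    (A : Finset ℂ) (s : ℂ) (hA : ∀ B : Finset ℂ, QM.eRk (XX V E0 A) + Module.finrank ℚ (LL V B) ≤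
      QM.eRk (XX V E0 B) + Module.finrank ℚ (LL V A)) (hs : ZeroAt T C (ms s))
    (hne : V ⊓ (LL V A).comap (ms s) ≠ V) :
    ∀ c ∈ C, ∀ t ∈ T, ∑ v ∈ T with v - t ∈ V ⊓ (LL V A).comap (ms s), c v * exp (ms s v) = 0 := by
  classical
  set V' := V ⊓ (LL V A).comap (ms s) with hV'
  set X := XX V E0 A with hXdef
  have hX : QM.eRk X ≠ ⊤ := XX_fin V E0 hE0 A
  have hE0X : E0 ⊆ X := subset_union_left.trans subset_union_left
  have hs0 : s ≠ 0 := by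
    rintro rfl
    apply hne
    refine inf_eq_left.mpr fun v _ => ?_
    simp [ms_apply]
  have hinj : Function.Injective (ms s) := fun a b h => mul_right_cancel₀ hs0 h
  obtain ⟨Q, hQ⟩ := Submodule.exists_isCompl V'
  have hV'V : V' ≤ V := inf_le_left
  let U := Q ⊓ V
  have : FiniteDimensional ℚ U := Submodule.finiteDimensional_of_le inf_le_right
  have hsup : V' ⊔ U = V := by
    rw [← sup_inf_assoc_of_le Q hV'V, hQ.sup_eq_top, top_inf_eq]
  have hinf : V' ⊓ U = ⊥ := by
    rw [← inf_assoc, hQ.inf_eq_bot, bot_inf_eq]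
  have hL : LL V (insert s A) = LL V A ⊔ U.map (ms s) := by
    have : LL V (insert s A) = V.map (ms s) ⊔ LL V A := Finset.sup_insert
    rw [this]
    have h3 : V.map (ms s) = V'.map (ms s) ⊔ U.map (ms s) := by rw [← Submodule.map_sup, hsup]
    rw [h3]
    have h2 : V'.map (ms s) ≤ LL V A := Submodule.map_le_iff_le_comap.mpr inf_le_right
    rw [sup_comm (V'.map _), sup_assoc, sup_eq_right.mpr h2, sup_comm]
  have hd : Module.finrank ℚ (LL V (insert s A)) = Module.finrank ℚ (LL V A) + Module.finrank ℚ U := by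
    have h1 := Submodule.finrank_sup_add_finrank_inf_eq (LL V A) (U.map (ms s))
    have h2 : LL V A ⊓ U.map (ms s) = ⊥ := by
      rw [eq_bot_iff]
      rintro _ ⟨h3, u, hu, rfl⟩
      have : u ∈ V' ⊓ U := ⟨⟨hu.2, h3⟩, hu⟩
      rw [hinf] at this
      rw [(Submodule.mem_bot ℚ).mp this]; simp
    rw [← hL, h2, ← (Submodule.equivMapOfInjective (ms s) hinj U).finrank_eq] at h1
    simpa using h1
  have hmin := hA (insert s A)
  have hmin2 : QM.eRk X + Module.finrank ℚ U ≤ QM.eRk (XX V E0 (insert s A)) := by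
    rw [hd] at hmin
    push_cast at hmin
    rw [← add_assoc, add_right_comm] at hmin
    exact (ENat.add_le_add_iff_right (ENat.natCast_ne_top _)).mp hmin
  have hXs : XX V E0 (insert s A) ⊆ KK (insert s (X ∪ (fun v => exp (ms s v)) '' U)) := by
    rintro z ((hz | hz) | ⟨l, hl, rfl⟩)
    · exact subset_KK _ (Or.inr (Or.inl (hE0X hz)))
    · rw [Finset.coe_insert] at hz
      rcases hz with rfl | hz
      · exact subset_KK _ (mem_insert _ _)
      · exact subset_KK _ (Or.inr (Or.inl (Or.inl (Or.inr hz))))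
    · rw [hL] at hl
      obtain ⟨p, hp, _, ⟨u, hu, rfl⟩, rfl⟩ := Submodule.mem_sup.mp hl
      rw [exp_add]
      exact mul_mem (subset_KK _ (Or.inr (Or.inl (Or.inr ⟨p, hp, rfl⟩))))
        (subset_KK _ (Or.inr (Or.inr ⟨u, hu, rfl⟩)))
  by_cases hbot : V' = ⊥
  · exfalso
    have hUV : U = V := by rw [hbot] at hsup; simpa using hsup
    have hg := hG (ms s) hs
    set Y := E0 ∪ (fun v => exp (ms s v)) '' V with hY
    have h1 : QM.eRk (XX V E0 (insert s A)) ≤ QM.eRk (X ∪ Y) + 1 := by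
      refine (rk_le_of_subset_KK hXs).trans ((QM.eRk_insert_le_add_one _ _).trans ?_)
      grw [QM.eRk_mono (show X ∪ (fun v => exp (ms s v)) '' U ⊆ X ∪ Y from ?_)]
      rw [hUV]
      exact union_subset_union_right _ subset_union_right
    have h2 := QM.eRk_inter_add_eRk_union_le X Y
    have h3 : QM.eRk E0 ≤ QM.eRk (X ∩ Y) := QM.eRk_mono (subset_inter hE0X subset_union_left)
    have hYf : QM.eRk Y ≠ ⊤ := by
      intro h
      rw [h] at hg
      have := top_le_iff.mp hg
      exact WithTop.add_ne_top.mpr ⟨hE0, ENat.natCast_ne_top _⟩ this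
    rw [hUV] at hmin2
    generalize Module.finrank ℚ V = n at *
    have hXYf : QM.eRk (X ∪ Y) ≠ ⊤ := by
      refine ne_top_of_le_ne_top ?_ (QM.eRk_union_le_eRk_add_eRk X Y)
      exact WithTop.add_ne_top.mpr ⟨hX, hYf⟩
    have h4 := hmin2.trans h1
    have h5 := (add_le_add_left h3 (QM.eRk (X ∪ Y))).trans h2
    obtain ⟨a, ha⟩ := ENat.ne_top_iff_exists.mp hX
    obtain ⟨b, hb⟩ := ENat.ne_top_iff_exists.mp hYf
    obtain ⟨c, hc⟩ := ENat.ne_top_iff_exists.mp hXYf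
    obtain ⟨e, he⟩ := ENat.ne_top_iff_exists.mp hE0
    rw [← ha, ← hc] at h4
    rw [← ha, ← hb, ← hc, ← he] at h5
    rw [← hb, ← he] at hg
    norm_cast at h4 h5 hg
    omega
  · obtain ⟨v, hv, hv0⟩ := Submodule.exists_mem_ne_zero_of_ne_bot hbot
    have hsX : s ∈ KK X := by
      have h1 : v * s ∈ KK X := LL_KK V E0 hV A hv.2
      have h2 : v ∈ KK X := KK_mono hE0X (hV hv.1)
      have := div_mem h1 h2
      rwa [mul_div_cancel_left₀ _ hv0] at this
    have h1 : QM.eRk X + Module.finrank ℚ U ≤ QM.eRk (X ∪ (fun v => exp (ms s v)) '' U) := by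
      refine hmin2.trans (rk_le_of_subset_KK (hXs.trans (KK_le ?_)))
      rw [insert_subset_iff]
      exact ⟨KK_mono subset_union_left hsX, subset_KK _⟩
    intro c hc t ht
    refine coset_vanish hX V' U (disjoint_iff.mpr hinf) T (fun v hv => hsup ▸ hT v hv) c
      (fun v hv => KK_mono hE0X (hC c hc v hv)) (ms s) ?_ h1 (hs c hc) t ht
    intro v hv
    exact subset_KK _ (Or.inr ⟨_, hv.2, rfl⟩)

lemma main_ind (hSC : SchanuelConjecture) (E0 : Set ℂ) (hE0 : QM.eRk E0 ≠ ⊤) (n : ℕ) :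
    ∀ (V : Submodule ℚ ℂ) [FiniteDimensional ℚ V] (_ : Module.finrank ℚ V ≤ n)
    (_ : (V : Set ℂ) ⊆ KK E0) (T : Finset ℂ) (_ : ∀ v ∈ T, v ∈ V)
    (C : Set (ℂ → ℂ)) (_ : ∀ c ∈ C, ∀ v ∈ T, c v ∈ KK E0) (_ : Good V T C E0)
    (S : Set ℂ) (_ : S.Infinite) (_ : ∀ s ∈ S, ZeroAt T C (ms s)),
    ∃ S' ⊆ S, S'.Infinite ∧ FiniteDimensional ℚ (Submodule.span ℚ S') := by
  classical
  induction n with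
  | zero =>
    intro V _ hn hV T hT C hC hG S hS hz
    exfalso
    obtain ⟨s, hs⟩ := hS.nonempty
    have h1 := hG _ (hz s hs)
    have h2 := QM.eRk_mono (show E0 ⊆ E0 ∪ (fun v => exp (ms s v)) '' V from subset_union_left)
    rw [Nat.le_zero.mp hn] at h1
    have h3 := (add_le_add_left h2 2).trans h1
    obtain ⟨e, he⟩ := ENat.ne_top_iff_exists.mp hE0
    rw [← he] at h3
    norm_cast at h3
    omega
  | succ n ih =>
    intro V _ hn hV T hT C hC hG S hS hz
    obtain ⟨A, hA⟩ := exists_min hSC V E0 hE0 hV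
    let V' : ℂ → Submodule ℚ ℂ := fun s => V ⊓ (LL V A).comap (ms s)
    by_cases hV0 : V = ⊥
    · refine ih V (by subst hV0; simp) hV T hT C hC hG S hS hz
    obtain ⟨v, hv, hv0⟩ := Submodule.exists_mem_ne_zero_of_ne_bot hV0
    by_cases h1 : {s ∈ S | V' s = V}.Infinite
    · refine ⟨_, sep_subset _ _, h1, ?_⟩
      refine Submodule.finiteDimensional_of_le (S₂ := (LL V A).map (ms v⁻¹)) ?_
      refine Submodule.span_le.mpr ?_
      rintro s ⟨-, hs⟩
      have : v ∈ V' s := hs ▸ hv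
      refine ⟨_, this.2, ?_⟩
      simp only [ms_apply]
      field_simp
    have h2 : {s ∈ S | V' s ≠ V}.Infinite := by
      intro h
      apply hS
      refine ((not_infinite.mp h1).union h).subset ?_
      intro s hs
      by_cases h : V' s = V
      · exact Or.inl ⟨hs, h⟩
      · exact Or.inr ⟨hs, h⟩
    let r : ℂ → Finset (ℂ × ℂ) := fun s => (T ×ˢ T).filter fun p => p.1 - p.2 ∈ V' s
    obtain ⟨k, hk⟩ : ∃ k, ({s ∈ S | V' s ≠ V} ∩ r ⁻¹' {k}).Infinite := by
      by_contra hcon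
      push Not at hcon
      refine h2 (Set.Finite.of_finite_fibers r ?_ fun k _ => hcon k)
      refine ((T ×ˢ T).powerset.finite_toSet).subset ?_
      rintro _ ⟨s, _, rfl⟩
      simp only [Finset.coe_powerset, mem_preimage, mem_powerset_iff, Finset.coe_subset, r]
      exact Finset.filter_subset _ _
    obtain ⟨s0, ⟨hs0S, hs0V⟩, hs0k⟩ := hk.nonempty
    have hr : ∀ s ∈ {s ∈ S | V' s ≠ V} ∩ r ⁻¹' {k}, ∀ v ∈ T, ∀ t ∈ T,
        (v - t ∈ V' s ↔ v - t ∈ V' s0) := by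
      intro s hs v hv t ht
      have h3 : r s = r s0 := by rw [hs.2, hs0k]
      have h4 := Finset.ext_iff.mp h3 (v, t)
      simpa [r, hv, ht] using h4
    have hlt : V' s0 < V := lt_of_le_of_ne inf_le_left hs0V
    have hfd : FiniteDimensional ℚ (V' s0) := Submodule.finiteDimensional_of_le hlt.le
    have hfin := Submodule.finrank_lt_finrank_of_lt hlt
    obtain ⟨S', hS', hS'i, hS'f⟩ := ih (V' s0) (by omega) (fun x hx => hV (hlt.le hx)) (newT (V' s0) T)
      (fun u hu => (mem_newT.mp hu).2) (newC T C) (by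
        rintro _ ⟨c, hc, t, ht, rfl⟩ u hu
        dsimp only
        split_ifs with h
        · exact hC c hc _ h
        · exact zero_mem _)
      (good_inherit V (V' s0) (V' s0) hlt.le T C E0 hE0 (fun u hu => (mem_newT.mp hu).2) hG)
      _ hk (by
        rintro s hs _ ⟨c, hc, t, ht, rfl⟩
        have h5 := step V E0 hE0 hV T hT C hC hG A s hA (hz s hs.1.1) hs.1.2 c hc t ht
        have h6 := sum_shift (V' s0) T c (ms s) t ht
        have h7 : ∑ v ∈ T with v - t ∈ V' s0, c v * exp (ms s v) = 0 := by
          rw [← h5]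
          refine Finset.sum_congr (Finset.filter_congr fun v hv => (hr s hs v hv t ht).symm) fun _ _ => rfl
        rw [h7] at h6
        exact (mul_eq_zero.mp h6).resolve_left (exp_ne_zero _))
    exact ⟨S', fun s hs => (hS' hs).1.1, hS'i, hS'f⟩

abbrev RR := AddMonoidAlgebra ℂ ℂ

def chr (φ : ℂ →ₗ[ℚ] ℂ) : Multiplicative ℂ →* ℂ where
  toFun v := exp (φ v.toAdd)
  map_one' := by simp
  map_mul' := by intro a b; simp [exp_add]

def ev (φ : ℂ →ₗ[ℚ] ℂ) : RR →ₐ[ℂ] ℂ := AddMonoidAlgebra.lift ℂ ℂ ℂ (chr φ)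

lemma ev_single (φ : ℂ →ₗ[ℚ] ℂ) (v a : ℂ) : ev φ (AddMonoidAlgebra.single v a) = a * exp (φ v) := by
  rw [ev, AddMonoidAlgebra.lift_single, smul_eq_mul]; rfl

def Th : RR →+* (ℂ → ℂ) := RingHom.pi fun z => (ev (ms z)).toRingHom

lemma Th_apply (r : RR) (z : ℂ) : Th r z = ev (ms z) r := rfl

lemma Th_inj : Function.Injective Th := by
  let χ : ℂ → (Multiplicative ℂ →* ℂ) := fun v => chr (LinearMap.mulLeft ℚ v)
  have hχ : Function.Injective χ := by
    intro v w h
    by_contra hne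
    have ha : v - w ≠ 0 := sub_ne_zero.mpr hne
    have h1 := congrArg (fun F => F (Multiplicative.ofAdd (log 2 / (v - w)))) h
    have h2 : exp (v * (log 2 / (v - w))) = exp (w * (log 2 / (v - w))) := h1
    have h3 : exp ((v - w) * (log 2 / (v - w))) = 1 := by
      rw [sub_mul, exp_sub, h2, div_self (exp_ne_zero _)]
    rw [mul_div_cancel₀ _ ha, exp_log two_ne_zero] at h3
    norm_num at h3
  have hli := (linearIndependent_monoidHom (Multiplicative ℂ) ℂ).comp χ hχ
  rw [linearIndependent_iff] at hli
  rw [injective_iff_map_eq_zero]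
  intro r hr
  have h0 := hli r.coeff (by
    funext z
    have h1 := congrFun hr z.toAdd
    rw [Th_apply, ev, AddMonoidAlgebra.lift_apply] at h1
    rw [Finsupp.linearCombination_apply]
    rw [Finsupp.sum, Finset.sum_apply]
    exact h1)
  exact AddMonoidAlgebra.ext (by simpa using h0)

lemma exp_poly_Th {h : ℂ → ℂ} (hh : IsExpPoly h) : ∃ r, Th r = h := by
  obtain ⟨N, lam, mu, hN⟩ := hh
  refine ⟨∑ i, AddMonoidAlgebra.single (mu i) (lam i), ?_⟩
  funext z
  rw [Th_apply, map_sum, hN]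
  refine Finset.sum_congr rfl fun i _ => ?_
  rw [ev_single]; rfl

lemma Th_exp_poly (r : RR) : IsExpPoly (Th r) := by
  let e := r.coeff.support.equivFin
  refine ⟨r.coeff.support.card, fun i => r.coeff (e.symm i), fun i => (e.symm i : ℂ), fun z => ?_⟩
  rw [Th_apply, ev, AddMonoidAlgebra.lift_apply, Finsupp.sum, ← Finset.sum_coe_sort]
  rw [← e.symm.sum_comp]
  rfl

lemma EUnit_iff {h : ℂ → ℂ} : EUnit h ↔ ∃ u : RRˣ, Th u = h := by
  constructor
  · rintro ⟨h1, g, h2, h3⟩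
    obtain ⟨r, rfl⟩ := exp_poly_Th h1
    obtain ⟨r', rfl⟩ := exp_poly_Th h2
    have : r * r' = 1 := Th_inj (by rw [map_mul, h3, map_one])
    exact ⟨⟨r, r', this, by rw [mul_comm, this]⟩, rfl⟩
  · rintro ⟨u, rfl⟩
    refine ⟨Th_exp_poly _, Th (u⁻¹ : RRˣ), Th_exp_poly _, ?_⟩
    rw [← map_mul, Units.mul_inv, map_one]

lemma irr_split {f : ℂ → ℂ} (hf : EIrreducible f) (φ : ℂ →ₗ[ℚ] ℂ) (a d : RR)
    (h : f = Th (a * d)) (ha : ev φ a = 0) : ∃ u : RRˣ, f = Th (a * u) := by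
  rcases hf.2.2.2 (Th a) (Th d) (Th_exp_poly _) (Th_exp_poly _) (by rw [h, map_mul]) with h1 | h1
  · obtain ⟨u, hu⟩ := EUnit_iff.mp h1
    have h2 := Th_inj hu
    have h3 := u.isUnit.map (ev φ)
    rw [h2, ha] at h3
    exact absurd h3 (by simp)
  · obtain ⟨u, hu⟩ := EUnit_iff.mp h1
    exact ⟨u, by rw [h, Th_inj hu]⟩

def al (K : IntermediateField ℚ ℂ) {n : ℕ} (b : Fin n → ℂ) : MvPolynomial (Fin n) K →+* RR :=
  MvPolynomial.eval₂Hom ((algebraMap ℂ RR).comp (algebraMap K ℂ)) fun i => AddMonoidAlgebra.single (b i) 1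

lemma ev_al (K : IntermediateField ℚ ℂ) {n : ℕ} (b : Fin n → ℂ) (φ : ℂ →ₗ[ℚ] ℂ)
    (P : MvPolynomial (Fin n) K) :
    ev φ (al K b P) = MvPolynomial.aeval (fun i => exp (φ (b i))) P := by
  have : (ev φ).toRingHom.comp (al K b) = (MvPolynomial.aeval (fun i => exp (φ (b i)))).toRingHom := by
    apply MvPolynomial.ringHom_ext
    · intro r; simp [al, ev_single]
    · intro i; simp [al, ev_single]
  exact congrArg (fun F => F P) this

set_option maxHeartbeats 1000000 in
lemma exists_factor {K : IntermediateField ℚ ℂ} {n : ℕ} (b : Fin n → ℂ) (w : ℂ) (T : Finset ℂ)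
    (e : ℂ → (Fin n →₀ ℕ)) (he : ∀ v ∈ T, v + w = ∑ i, (e v i) • b i) (c : ℂ → ℂ)
    (hc : ∀ v ∈ T, c v ∈ K) {f : ℂ → ℂ} (hf : EIrreducible f)
    (hfc : ∀ z, f z = ∑ v ∈ T, c v * exp (v * z)) (φ : ℂ →ₗ[ℚ] ℂ)
    (hφ : ∑ v ∈ T, c v * exp (φ v) = 0) :
    ∃ P : MvPolynomial (Fin n) K, Irreducible P ∧
      MvPolynomial.aeval (fun i => exp (φ (b i))) P = 0 ∧ ∃ u : RRˣ, f = Th (al K b P * u) := by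
  classical
  let a : ℂ → K := fun v => if h : v ∈ T then ⟨_, hc v h⟩ else 0
  have ha : ∀ v ∈ T, (a v : ℂ) = c v := fun v hv => by simp [a, hv]
  let P0 : MvPolynomial (Fin n) K := ∑ v ∈ T, MvPolynomial.monomial (e v) (a v)
  have h0 : al K b P0 = ∑ v ∈ T, AddMonoidAlgebra.single (v + w) (c v) := by
    rw [map_sum]
    refine Finset.sum_congr rfl fun v hv => ?_
    rw [al, MvPolynomial.eval₂Hom_monomial, Finsupp.prod_fintype _ _ (by simp), he v hv]
    simp only [AddMonoidAlgebra.single_pow, one_pow]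
    have h1 : ∏ i, (AddMonoidAlgebra.single (e v i • b i) 1 : RR) =
        AddMonoidAlgebra.single (∑ i, e v i • b i) 1 := by
      have := map_prod (AddMonoidAlgebra.of ℂ ℂ) (fun i => Multiplicative.ofAdd (e v i • b i)) Finset.univ
      rw [← ofAdd_sum] at this
      exact this.symm
    rw [h1]
    simp [AddMonoidAlgebra.single_mul_single, ha v hv]
  have hF : f = Th (AddMonoidAlgebra.single (-w) 1 * al K b P0) := by
    funext z
    rw [Th_apply, h0, Finset.mul_sum, map_sum, hfc]
    refine Finset.sum_congr rfl fun v hv => ?_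
    rw [AddMonoidAlgebra.single_mul_single, ev_single, ms_apply]
    congr 2 <;> ring_nf
  have hP0 : P0 ≠ 0 := by
    intro h
    apply hf.2.1
    rw [hF, h, map_zero, mul_zero, map_zero]
  have hx : MvPolynomial.aeval (fun i => exp (φ (b i))) P0 = 0 := by
    rw [← ev_al, h0, map_sum]
    have : ∀ v ∈ T, ev φ (AddMonoidAlgebra.single (v + w) (c v)) = c v * exp (φ v) * exp (φ w) := by
      intro v _
      rw [ev_single, map_add, exp_add, mul_assoc]
    rw [Finset.sum_congr rfl this, ← Finset.sum_mul, hφ, zero_mul]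
  obtain ⟨m, hm, u, hu⟩ := UniqueFactorizationMonoid.exists_prime_factors P0 hP0
  rw [← hu, map_mul] at hx
  have hx2 := (mul_eq_zero.mp hx).resolve_right (u.isUnit.map _).ne_zero
  rw [map_multiset_prod, Multiset.prod_eq_zero_iff] at hx2
  obtain ⟨P, hPm, hPx⟩ := Multiset.mem_map.mp hx2
  refine ⟨P, (hm P hPm).irreducible, hPx, ?_⟩
  obtain ⟨D, hD⟩ : P ∣ P0 := hu ▸ (Multiset.dvd_prod hPm).mul_right _
  refine irr_split hf φ _ (al K b D * AddMonoidAlgebra.single (-w) 1) ?_ (by rw [ev_al, hPx])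
  rw [hF, hD, map_mul (al K b), mul_comm, mul_assoc]

lemma good_init (V : Submodule ℚ ℂ) [FiniteDimensional ℚ V] (T : Finset ℂ) (hT : ∀ v ∈ T, v ∈ V)
    (c d : ℂ → ℂ) (E0 : Set ℂ) (hE0 : QM.eRk E0 ≠ ⊤) (hc : ∀ v ∈ T, c v ∈ KK E0)
    (hd : ∀ v ∈ T, d v ∈ KK E0) {f g : ℂ → ℂ} (hf : EIrreducible f) (hg : EIrreducible g)
    (hfc : ∀ z, f z = ∑ v ∈ T, c v * exp (v * z)) (hgd : ∀ z, g z = ∑ v ∈ T, d v * exp (v * z))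
    (hdist : ¬ ∃ u : ℂ → ℂ, EUnit u ∧ f = u * g) : Good V T {c, d} E0 := by
  classical
  intro φ hφ
  by_contra hcon
  obtain ⟨b, w, e, -, he⟩ := lattice V T hT
  obtain ⟨P, hP, hPx, u, hu⟩ := exists_factor (fun i => (b i : ℂ)) w T e he c hc hf hfc φ
    (hφ c (by simp))
  obtain ⟨Q, hQ, hQx, u', hu'⟩ := exists_factor (fun i => (b i : ℂ)) w T e he d hd hg hgd φ
    (hφ d (by simp))
  set x : Fin (Module.finrank ℚ V) → ℂ := fun i => exp (φ (b i)) with hxdef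
  have hr1 : QM.eRk (E0 ∪ (fun v => exp (φ v)) '' V) ≤ QM.eRk (E0 ∪ range x) := by
    refine rk_le_of_subset_KK (union_subset ?_ ?_)
    · exact subset_union_left.trans (subset_KK _)
    · exact (exp_image_subset_KK V b φ).trans (KK_mono subset_union_right)
  have hlt : QM.eRk E0 + Module.finrank ℚ V < QM.eRk (E0 ∪ range x) + 2 :=
    (not_le.mp hcon).trans_le (by grw [hr1])
  have hex : ∃ i, x i ∈ KK (E0 ∪ x '' {i}ᶜ) := by
    by_contra hno
    push Not at hno
    have h1 := rk_union_image x hno Finset.univ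
    rw [Finset.coe_univ, image_univ, Finset.card_univ] at h1
    have h2 := algInd_of_rk x hE0 h1.ge
    exact hP.ne_zero (h2 (hPx.trans (map_zero _).symm))
  obtain ⟨i, hi⟩ := hex
  have hr2 : QM.eRk (E0 ∪ range x) ≤ QM.eRk (E0 ∪ x '' {i}ᶜ) := by
    refine rk_le_of_subset_KK (union_subset (subset_union_left.trans (subset_KK _)) ?_)
    rintro _ ⟨j, rfl⟩
    by_cases hj : j = i
    · rw [hj]; exact hi
    · exact subset_KK _ (Or.inr ⟨j, hj, rfl⟩)
  let y : {j // j ≠ i} → ℂ := fun j => x j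
  have hy : AlgebraicIndependent (KK E0) y := by
    apply algInd_of_rk y hE0
    have h1 : x '' {i}ᶜ = range y := by
      ext z
      simp only [mem_image, mem_range, y, Subtype.exists, mem_compl_iff, mem_singleton_iff, exists_prop, ne_eq]
    rw [← h1]
    have h2 : Fintype.card {j // j ≠ i} = Module.finrank ℚ V - 1 := by
      rw [Fintype.card_subtype_compl, Fintype.card_fin]; simp
    rw [h2]
    have h3 : 1 ≤ Module.finrank ℚ V := by have := i.2; omega
    have h4 := hlt.trans_le (add_le_add_left hr2 2)
    by_cases htop : QM.eRk (E0 ∪ x '' {i}ᶜ) = ⊤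
    · rw [htop]; exact le_top
    obtain ⟨k, hk⟩ := ENat.ne_top_iff_exists.mp htop
    obtain ⟨e, he⟩ := ENat.ne_top_iff_exists.mp hE0
    rw [← hk, ← he] at h4 ⊢
    norm_cast at h4 ⊢
    omega
  have hdvd : P ∣ Q := by
    let E := Equiv.optionSubtypeNe i
    let R := MvPolynomial.renameEquiv (KK E0) E.symm
    have hR : ∀ p, MvPolynomial.aeval (x ∘ E) (R p) = MvPolynomial.aeval x p := by
      intro p
      change MvPolynomial.aeval (x ∘ E) (MvPolynomial.rename E.symm p) = _
      rw [MvPolynomial.aeval_rename]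
      congr 2
      funext j; simp
    have := gauss (K := KK E0) (x ∘ E) hy (R P) (R Q)
      ((MulEquiv.irreducible_iff R.toMulEquiv).mpr hP) ((hR P).trans hPx) ((hR Q).trans hQx)
    exact (map_dvd_iff R.toMulEquiv).mp this
  obtain ⟨v, hv⟩ := hP.associated_of_dvd hQ hdvd
  apply hdist
  let v' : RRˣ := Units.map (al (KK E0) (fun i => (b i : ℂ))).toMonoidHom v
  refine ⟨Th (u * u'⁻¹ * v'⁻¹ : RRˣ), EUnit_iff.mpr ⟨_, rfl⟩, ?_⟩
  rw [hu, hu', ← map_mul, ← hv, map_mul (al _ _)]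
  congr 1
  have h7 : al (KK E0) (fun i => (b i : ℂ)) (v : MvPolynomial _ _) = (v' : RR) := rfl
  rw [h7]
  push_cast
  have h8 : (↑u * ↑u'⁻¹ * ↑v'⁻¹ * (al (KK E0) (fun i => (b i : ℂ)) P * v' * u') : RR) =
    al (KK E0) (fun i => (b i : ℂ)) P * u * (u'⁻¹ * u') * (v'⁻¹ * v') := by ring
  rw [h8, Units.inv_mul, Units.inv_mul, mul_one, mul_one]

def expU : ℂ →+ Additive ℂˣ where
  toFun z := Additive.ofMul (Units.mk0 (exp z) (exp_ne_zero z))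
  map_zero' := by
    rw [← ofMul_one]; congr 1; ext; simp
  map_add' a b := by
    rw [← ofMul_mul]; congr 1; ext; simp [exp_add]

open scoped TensorProduct in
lemma final_fd {N : ℕ} (mu : Fin N → ℂ) (S' : Set ℂ) [FiniteDimensional ℚ (Submodule.span ℚ S')]
    (G : Subgroup ℂˣ)
    (hG : G = Subgroup.closure {x : ℂˣ | ∃ i : Fin N, ∃ s ∈ S', (x : ℂ) = Complex.exp (mu i * s)}) :
    FiniteDimensional ℚ (ℚ ⊗[ℤ] Additive G) := by
  let H : Submodule ℚ ℂ := ⨆ i, (Submodule.span ℚ S').map (LinearMap.mulLeft ℚ (mu i))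
  have hH : FiniteDimensional ℚ H := by infer_instance
  let ψ : ℂ →ₗ[ℚ] (ℚ ⊗[ℤ] Additive ℂˣ) :=
    (((TensorProduct.mk ℤ ℚ (Additive ℂˣ)) 1).toAddMonoidHom.comp expU).toRatLinearMap
  have hψ : ∀ z, ψ z = (1 : ℚ) ⊗ₜ[ℤ] expU z := fun z => rfl
  let ι : Additive G →ₗ[ℤ] Additive ℂˣ := (MonoidHom.toAdditive G.subtype).toIntLinearMap
  have hι : Function.Injective ι := by
    intro a b h
    exact Subtype.val_injective h
  have hinj : Function.Injective (ι.baseChange ℚ) :=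
    Module.Flat.lTensor_preserves_injective_linearMap (M := ℚ) ι hι
  have hmem : ∀ g ∈ G, ∃ h ∈ H, expU h = Additive.ofMul g := by
    intro g hg
    rw [hG] at hg
    induction hg using Subgroup.closure_induction with
    | mem x hx =>
      obtain ⟨i, s, hs, h⟩ := hx
      refine ⟨mu i * s, ?_, ?_⟩
      · exact Submodule.mem_iSup_of_mem i ⟨s, Submodule.subset_span hs, rfl⟩
      · change Additive.ofMul _ = _
        congr 1; ext; simp [h]
    | one => exact ⟨0, zero_mem _, by simp⟩
    | mul x y _ _ h1 h2 =>
      obtain ⟨a, ha, ha'⟩ := h1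
      obtain ⟨b, hb, hb'⟩ := h2
      exact ⟨a + b, add_mem ha hb, by rw [map_add, ha', hb', ofMul_mul]⟩
    | inv x _ h1 =>
      obtain ⟨a, ha, ha'⟩ := h1
      exact ⟨-a, neg_mem ha, by rw [map_neg, ha', ofMul_inv]⟩
  have hle : LinearMap.range (ι.baseChange ℚ) ≤ H.map ψ := by
    rintro _ ⟨t, rfl⟩
    induction t using TensorProduct.induction_on with
    | zero => simp
    | add a b h1 h2 => rw [map_add]; exact add_mem h1 h2
    | tmul q g =>
      obtain ⟨h, hh, hg⟩ := hmem _ g.toMul.2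
      refine ⟨q • h, H.smul_mem q hh, ?_⟩
      rw [map_smul, hψ, TensorProduct.smul_tmul', smul_eq_mul, mul_one, hg]
      rfl
  have h3 : FiniteDimensional ℚ (LinearMap.range (ι.baseChange ℚ)) :=
    Submodule.finiteDimensional_of_le hle
  exact Module.Finite.equiv (LinearEquiv.ofInjective _ hinj).symm

lemma coef_mem {N : ℕ} (lam mu : Fin N → ℂ) (K : IntermediateField ℚ ℂ) (h : ∀ i, lam i ∈ K) (v : ℂ) :
    (∑ i, if mu i = v then lam i else 0) ∈ K := by
  refine sum_mem fun i _ => ?_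
  split_ifs
  · exact h i
  · exact zero_mem _

lemma coef_sum {N : ℕ} (lam mu : Fin N → ℂ) (T : Finset ℂ) (hT : ∀ i, mu i ∈ T) (F : ℂ → ℂ) :
    ∑ v ∈ T, (∑ i, if mu i = v then lam i else 0) * F v = ∑ i, lam i * F (mu i) := by
  simp only [Finset.sum_mul]
  rw [Finset.sum_comm]
  refine Finset.sum_congr rfl fun i _ => ?_
  simp [hT i]

open scoped TensorProduct in
/-- Assuming Schanuel's Conjecture: for some infinite `S' ⊆ S`, the subgroup of `ℂˣ`
generated by the `e^{μᵢ s}` (`s ∈ S'`) has finite rank, i.e. its divisible hull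
`ℚ ⊗_ℤ G` is a finite dimensional `ℚ`-vector space. -/
theorem divisible_hull_finite_rank (hSC : SchanuelConjecture)
    (f g : ℂ → ℂ) (N M : ℕ) (lam mu : Fin N → ℂ) (l em : Fin M → ℂ)
    (hfrep : IsCanonicalRep f lam mu) (hgrep : IsCanonicalRep g l em)
    (hfirr : EIrreducible f) (hgirr : EIrreducible g)
    (hdist : ¬ ∃ u : ℂ → ℂ, EUnit u ∧ f = u * g)
    (S : Set ℂ) (hSinf : S.Infinite)
    (hS : ∀ s ∈ S, s ≠ 0 ∧ f s = 0 ∧ g s = 0)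
 :
    ∃ S' ⊆ S, S'.Infinite ∧
      ∀ G : Subgroup ℂˣ,
        G = Subgroup.closure {x : ℂˣ | ∃ i : Fin N, ∃ s ∈ S', (x : ℂ) = Complex.exp (mu i * s)} →
        FiniteDimensional ℚ (ℚ ⊗[ℤ] Additive G) := by
  classical
  let E0 : Set ℂ := range lam ∪ range l ∪ (range mu ∪ range em)
  have hE0fin : E0.Finite := ((finite_range _).union (finite_range _)).union
    ((finite_range _).union (finite_range _))
  have hE0 : QM.eRk E0 ≠ ⊤ :=
    ne_top_of_le_ne_top (Set.encard_ne_top_iff.mpr hE0fin) (QM.eRk_le_encard E0)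
  let V : Submodule ℚ ℂ := Submodule.span ℚ (range mu ∪ range em)
  have hVfd : FiniteDimensional ℚ V :=
    FiniteDimensional.span_of_finite ℚ ((finite_range _).union (finite_range _))
  have hV : (V : Set ℂ) ⊆ KK E0 := span_mem_KK (subset_union_right.trans (subset_KK _))
  let T : Finset ℂ := Finset.univ.image mu ∪ Finset.univ.image em
  have hTmu : ∀ i, mu i ∈ T := fun i =>
    Finset.mem_union_left _ (Finset.mem_image_of_mem _ (Finset.mem_univ i))
  have hTem : ∀ i, em i ∈ T := fun i =>
    Finset.mem_union_right _ (Finset.mem_image_of_mem _ (Finset.mem_univ i))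
  have hT : ∀ v ∈ T, v ∈ V := by
    intro v hv
    rcases Finset.mem_union.mp hv with h | h
    · obtain ⟨i, -, rfl⟩ := Finset.mem_image.mp h
      exact Submodule.subset_span (Or.inl ⟨i, rfl⟩)
    · obtain ⟨i, -, rfl⟩ := Finset.mem_image.mp h
      exact Submodule.subset_span (Or.inr ⟨i, rfl⟩)
  let c : ℂ → ℂ := fun v => ∑ i, if mu i = v then lam i else 0
  let d : ℂ → ℂ := fun v => ∑ i, if em i = v then l i else 0
  have hc : ∀ v, c v ∈ KK E0 :=
    coef_mem lam mu _ fun i => subset_KK _ (Or.inl (Or.inl ⟨i, rfl⟩))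
  have hd : ∀ v, d v ∈ KK E0 :=
    coef_mem l em _ fun i => subset_KK _ (Or.inl (Or.inr ⟨i, rfl⟩))
  have hfc : ∀ z, f z = ∑ v ∈ T, c v * exp (v * z) := by
    intro z
    rw [hfrep.2.2 z]
    exact (coef_sum lam mu T hTmu fun v => exp (v * z)).symm
  have hgd : ∀ z, g z = ∑ v ∈ T, d v * exp (v * z) := by
    intro z
    rw [hgrep.2.2 z]
    exact (coef_sum l em T hTem fun v => exp (v * z)).symm
  have hG := good_init V T hT c d E0 hE0 (fun v _ => hc v) (fun v _ => hd v) hfirr hgirr hfc hgd hdist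
  obtain ⟨S', h1, h2, h3⟩ := main_ind hSC E0 hE0 _ V le_rfl hV T hT {c, d} (by
      rintro a (rfl | rfl) v -
      · exact hc v
      · exact hd v) hG S hSinf (by
      rintro s hs a (rfl | rfl)
      · have := (hS s hs).2.1
        rw [hfc] at this
        exact this
      · have := (hS s hs).2.2
        rw [hgd] at this
        exact this)
  exact ⟨S', h1, h2, fun G hGG => final_fd mu S' G hGG⟩
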